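/- Let M, N, K be positive integers, A ∈ ℝ^{M×N}, P ∈ ℝ^{M×K}, Q ∈ ℝ^{K×N}. Set c₁ = 3 and c₂ = ‖A‖_F, and define F(U,Z) = ⟨P,U⟩_F + ⟨Q,Z⟩_F + c₁·((‖U‖_F² + ‖Z‖_F²)/2)² + c₂·(‖U‖_F² + ‖Z‖_F²)/2. If r ≥ 0 satisfies c₁(‖Π₊(−P)‖_F² + ‖Π₊(−Q)‖_F²)·r³ + c₂·r − 1 = 0, then (U*, Z*) = (r·Π₊(−P), r·Π₊(−Q)) minimizes F over the set {(U,Z) : U ≥ 0, Z ≥ 0}. -/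

import Mathlib

/-- Frobenius inner product of real matrices. -/
noncomputable def fip {m n : ℕ} (X Y : Matrix (Fin m) (Fin n) ℝ) : ℝ :=
  ∑ i, ∑ j, X i j * Y i j

/-- Frobenius norm of a real matrix. -/
noncomputable def fnorm {m n : ℕ} (X : Matrix (Fin m) (Fin n) ℝ) : ℝ :=
  Real.sqrt (fip X X)

/-- Entrywise positive part Π₊. -/
def pp {m n : ℕ} (Y : Matrix (Fin m) (Fin n) ℝ) : Matrix (Fin m) (Fin n) ℝ :=
  fun i j => max (Y i j) 0

theorem fip_self_nonneg {m n : ℕ} (X : Matrix (Fin m) (Fin n) ℝ) : 0 ≤ fip X X :=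
  Finset.sum_nonneg fun _ _ => Finset.sum_nonneg fun _ _ => mul_self_nonneg _

theorem fnorm_sq {m n : ℕ} (X : Matrix (Fin m) (Fin n) ℝ) : fnorm X ^ 2 = fip X X :=
  Real.sq_sqrt (fip_self_nonneg X)

theorem fip_smul_right {m n : ℕ} (X Y : Matrix (Fin m) (Fin n) ℝ) (r : ℝ) :
    fip X (r • Y) = r * fip X Y := by
  simp only [fip, Finset.mul_sum, Matrix.smul_apply, smul_eq_mul]
  exact Finset.sum_congr rfl fun _ _ => Finset.sum_congr rfl fun _ _ => by ring

theorem fnorm_smul_sq {m n : ℕ} (X : Matrix (Fin m) (Fin n) ℝ) (r : ℝ) :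
    fnorm (r • X) ^ 2 = r ^ 2 * fnorm X ^ 2 := by
  simp only [fnorm_sq, fip, Finset.mul_sum, Matrix.smul_apply, smul_eq_mul]
  exact Finset.sum_congr rfl fun _ _ => Finset.sum_congr rfl fun _ _ => by ring

theorem fip_pp_neg {m n : ℕ} (X : Matrix (Fin m) (Fin n) ℝ) :
    fip X (pp (-X)) = -fnorm (pp (-X)) ^ 2 := by
  simp only [fnorm_sq, fip, ← Finset.sum_neg_distrib]
  refine Finset.sum_congr rfl fun i _ => Finset.sum_congr rfl fun j _ => ?_
  simp only [pp, Matrix.neg_apply]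
  rcases max_cases (-X i j) 0 with ⟨h, -⟩ | ⟨h, -⟩ <;> rw [h] <;> ring

/-- Lower bound on a linear form over the nonnegative orthant, by Young's inequality
with weights `l` and `r = l⁻¹`. -/
theorem neg_young_le_fip {m n : ℕ} (X U : Matrix (Fin m) (Fin n) ℝ) (hU : ∀ i j, 0 ≤ U i j)
    {l r : ℝ} (hr : 0 ≤ r) (hlr : l * r = 1) :
    -(l / 2 * fnorm U ^ 2 + r / 2 * fnorm (pp (-X)) ^ 2) ≤ fip X U := by
  simp only [fnorm_sq, fip, Finset.mul_sum, ← Finset.sum_add_distrib, ← Finset.sum_neg_distrib]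
  refine Finset.sum_le_sum fun i _ => Finset.sum_le_sum fun j _ => ?_
  have hX : -X i j ≤ pp (-X) i j := le_max_left _ _
  have hl : 0 ≤ l := by
    by_contra! h
    nlinarith [mul_nonneg hr (neg_nonneg.2 h.le)]
  have hsq : 0 ≤ l * (U i j - r * pp (-X) i j) ^ 2 := mul_nonneg hl (sq_nonneg _)
  have hexp : l * (U i j - r * pp (-X) i j) ^ 2 =
      l * U i j ^ 2 - 2 * (U i j * pp (-X) i j) + r * pp (-X) i j ^ 2 := by
    linear_combination (r * pp (-X) i j ^ 2 - 2 * U i j * pp (-X) i j) * hlr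
  nlinarith [mul_le_mul_of_nonneg_right hX (hU i j)]

/-- if r ≥ 0 solves 3(‖Π₊(−P)‖²+‖Π₊(−Q)‖²)r³ + ‖A‖_F r − 1 = 0, then
(U*,Z*) = (r·Π₊(−P), r·Π₊(−Q)) minimizes the BPG subproblem objective
F(U,Z) = ⟨P,U⟩ + ⟨Q,Z⟩ + 3((‖U‖²+‖Z‖²)/2)² + ‖A‖_F(‖U‖²+‖Z‖²)/2 over entrywise
nonnegative pairs (U,Z). -/
theorem stmt14 (M N K : ℕ) (hM : 0 < M) (hN : 0 < N) (hK : 0 < K)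
    (A : Matrix (Fin M) (Fin N) ℝ)
    (P : Matrix (Fin M) (Fin K) ℝ) (Q : Matrix (Fin K) (Fin N) ℝ)
    (r : ℝ) (hr : 0 ≤ r)
    (hcubic : 3 * (fnorm (pp (-P)) ^ 2 + fnorm (pp (-Q)) ^ 2) * r ^ 3 +
      fnorm A * r - 1 = 0) :
    (∀ i j, 0 ≤ (r • pp (-P)) i j) ∧ (∀ i j, 0 ≤ (r • pp (-Q)) i j) ∧
    ∀ (U : Matrix (Fin M) (Fin K) ℝ) (Z : Matrix (Fin K) (Fin N) ℝ),
      (∀ i j, 0 ≤ U i j) → (∀ i j, 0 ≤ Z i j) →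
      fip P (r • pp (-P)) + fip Q (r • pp (-Q)) +
          3 * ((fnorm (r • pp (-P)) ^ 2 + fnorm (r • pp (-Q)) ^ 2) / 2) ^ 2 +
          fnorm A * ((fnorm (r • pp (-P)) ^ 2 + fnorm (r • pp (-Q)) ^ 2) / 2) ≤
        fip P U + fip Q Z +
          3 * ((fnorm U ^ 2 + fnorm Z ^ 2) / 2) ^ 2 +
          fnorm A * ((fnorm U ^ 2 + fnorm Z ^ 2) / 2) := by
  have hpp {m n : ℕ} (X : Matrix (Fin m) (Fin n) ℝ) (i j) : 0 ≤ (r • pp X) i j :=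
    mul_nonneg hr (le_max_right _ _)
  refine ⟨hpp _, hpp _, fun U Z hU hZ => ?_⟩
  have hlr : (3 * (r ^ 2 * (fnorm (pp (-P)) ^ 2 + fnorm (pp (-Q)) ^ 2)) + fnorm A) * r = 1 := by
    linear_combination hcubic
  have hPU := neg_young_le_fip P U hU hr hlr
  have hQZ := neg_young_le_fip Q Z hZ hr hlr
  simp only [fip_smul_right, fnorm_smul_sq, fip_pp_neg]
  generalize fnorm (pp (-P)) ^ 2 = p at *
  generalize fnorm (pp (-Q)) ^ 2 = q at *
  have hs : (3 * (r ^ 2 * (p + q)) + fnorm A) * (r ^ 2 * (p + q)) = r * (p + q) := by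
    linear_combination r * (p + q) * hlr
  linarith [sq_nonneg (fnorm U ^ 2 + fnorm Z ^ 2 - r ^ 2 * (p + q))]
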